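/- arXiv:2307.00917 — 3 statements merged into one kernel-verified Lean document; each statement's English description precedes it below -/
import Mathlib

section
/- If a connected graph G has second largest distance eigenvalue less than (-3+√5)/2, then G is chordal (every cycle of length at least 4 has a chord). -/
open Real

/-- The `k`-th largest eigenvalue (1-indexed, with multiplicity) of a real
symmetric matrix; junk value `0` if the matrix is not Hermitian. -/
noncomputable def kthLargestEig {V : Type*} [Fintype V] [DecidableEq V]
    (k : ℕ) (A : Matrix V V ℝ) : ℝ :=
  if h : A.IsHermitian then
    ((Finset.univ.val.map h.eigenvalues).sort (· ≤ ·)).getD (Fintype.card V - k) 0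
  else 0

/-- The second largest eigenvalue of a real symmetric matrix. -/
noncomputable def lambda2 {V : Type*} [Fintype V] [DecidableEq V]
    (A : Matrix V V ℝ) : ℝ := kthLargestEig 2 A

/-- The distance matrix of a graph (entries are graph distances, as reals). -/
noncomputable def distMatrix {V : Type*} [Fintype V] (G : SimpleGraph V) :
    Matrix V V ℝ := fun u v => (G.dist u v : ℝ)

/-- A graph is chordal if every cycle of length at least 4 has a chord, i.e. an
edge of the graph joining two vertices of the cycle that is not a cycle edge. -/
def SimpleGraph.Chordal {V : Type*} (G : SimpleGraph V) : Prop :=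
  ∀ (u : V) (w : G.Walk u u), w.IsCycle → 4 ≤ w.length →
    ∃ x y, x ∈ w.support ∧ y ∈ w.support ∧ G.Adj x y ∧ s(x, y) ∉ w.edges

open Matrix in
/-- A real symmetric matrix whose quadratic form is at least `μ` on the span of two
linearly independent vectors has second largest eigenvalue at least `μ`. -/
theorem le_lambda2_of_le_quadraticForm {V : Type*} [Fintype V] [DecidableEq V]
    {A : Matrix V V ℝ} (hA : A.IsHermitian) (hcard : 2 ≤ Fintype.card V) {μ : ℝ} (x y : V → ℝ)
    (hli : ∀ p q : ℝ, p • x + q • y = 0 → p = 0 ∧ q = 0)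
    (hform : ∀ p q : ℝ, μ * ((p • x + q • y) ⬝ᵥ (p • x + q • y)) ≤
      (p • x + q • y) ⬝ᵥ A *ᵥ (p • x + q • y)) : μ ≤ lambda2 A := by
  by_contra! hlt
  -- at most one eigenvalue is at least `μ`
  obtain ⟨i₀, hi₀⟩ : ∃ i₀, ∀ j, j ≠ i₀ → hA.eigenvalues j < μ := by
    unfold lambda2 kthLargestEig at hlt
    rw [dif_pos hA] at hlt
    set l := (Finset.univ.val.map hA.eigenvalues).sort (· ≤ ·) with hl
    have hlen : l.length = Fintype.card V := by simp [hl]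
    have hsorted : l.Pairwise (· ≤ ·) := Multiset.pairwise_sort _ _
    have hperm : (l : Multiset ℝ) = Finset.univ.val.map hA.eigenvalues := Multiset.sort_eq _ _
    have hcount : l.countP (fun t => decide (μ ≤ t)) ≤ 1 := by
      rw [← List.take_append_drop (Fintype.card V - 1) l, List.countP_append]
      have h1 : (l.take (Fintype.card V - 1)).countP (fun t => decide (μ ≤ t)) = 0 := by
        rw [List.countP_eq_zero]
        intro t ht
        obtain ⟨k, hk, rfl⟩ := List.mem_take_iff_getElem.1 ht
        have hk' : k ≤ Fintype.card V - 2 := by omega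
        have hN : Fintype.card V - 2 < l.length := by omega
        rw [List.getD_eq_getElem _ _ hN] at hlt
        have := hsorted.rel_get_of_le (a := ⟨k, by omega⟩) (b := ⟨Fintype.card V - 2, hN⟩) hk'
        simp only [List.get_eq_getElem] at this
        simpa using lt_of_le_of_lt this hlt
      have h2 := List.countP_le_length (p := fun t => decide (μ ≤ t))
        (l := l.drop (Fintype.card V - 1))
      rw [List.length_drop] at h2
      omega
    have hcard1 : (Finset.univ.filter fun i => μ ≤ hA.eigenvalues i).card ≤ 1 := by
      rw [← Multiset.coe_countP, hperm, Multiset.countP_map] at hcount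
      simpa [Finset.card_def] using hcount
    rw [Finset.card_le_one] at hcard1
    by_cases hex : ∃ i, μ ≤ hA.eigenvalues i
    · obtain ⟨i, hi⟩ := hex
      refine ⟨i, fun j hj => ?_⟩
      by_contra! hj'
      exact hj (hcard1 j (by simpa) i (by simpa))
    · push Not at hex
      have : 0 < Fintype.card V := by omega
      exact ⟨(Fintype.card_pos_iff.1 this).some, fun j _ => hex j⟩
  let b : V → V → ℝ := fun j => hA.eigenvectorBasis j
  have hparseval : ∀ v w : V → ℝ, ∑ j, (v ⬝ᵥ b j) * (b j ⬝ᵥ w) = v ⬝ᵥ w := fun v w => by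
    have := hA.eigenvectorBasis.sum_inner_mul_inner (WithLp.toLp 2 v) (WithLp.toLp 2 w)
    simpa [EuclideanSpace.inner_eq_star_dotProduct, dotProduct_comm, b] using this
  -- a nonzero vector of the span orthogonal to the exceptional eigenvector
  obtain ⟨p, q, hpq, horth⟩ : ∃ p q : ℝ, ¬ (p = 0 ∧ q = 0) ∧
      (p • x + q • y) ⬝ᵥ b i₀ = 0 := by
    by_cases hx : x ⬝ᵥ b i₀ = 0
    · exact ⟨1, 0, by simp, by simp [hx]⟩
    · refine ⟨- (y ⬝ᵥ b i₀), x ⬝ᵥ b i₀, fun h => hx h.2, ?_⟩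
      simp only [add_dotProduct, smul_dotProduct, smul_eq_mul]
      ring
  have hf := hform p q
  set v := p • x + q • y with hv
  have hv0 : v ≠ 0 := fun h => hpq (hli p q h)
  have hform' : v ⬝ᵥ A *ᵥ v = ∑ j, hA.eigenvalues j * (v ⬝ᵥ b j) ^ 2 := by
    rw [← hparseval]
    refine Finset.sum_congr rfl fun j _ => ?_
    have hsymm : Aᵀ = A := by simpa [IsHermitian, conjTranspose_eq_transpose_of_trivial] using hA
    have : b j ⬝ᵥ A *ᵥ v = hA.eigenvalues j * (v ⬝ᵥ b j) := by
      rw [dotProduct_mulVec, ← mulVec_transpose, hsymm, hA.mulVec_eigenvectorBasis j,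
        smul_dotProduct, dotProduct_comm, smul_eq_mul]
    rw [this]
    ring
  have hnorm : v ⬝ᵥ v = ∑ j, (v ⬝ᵥ b j) ^ 2 := by
    rw [← hparseval]
    exact Finset.sum_congr rfl fun j _ => by rw [dotProduct_comm (b j), sq]
  have hpos : 0 < v ⬝ᵥ v := by
    refine lt_of_le_of_ne (Finset.sum_nonneg fun i _ => mul_self_nonneg _) fun h => hv0 ?_
    exact dotProduct_self_eq_zero.1 h.symm
  obtain ⟨j, -, hj⟩ : ∃ j ∈ Finset.univ, (v ⬝ᵥ b j) ^ 2 ≠ 0 :=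
    Finset.exists_ne_zero_of_sum_ne_zero (hnorm ▸ hpos.ne')
  have hjne : j ≠ i₀ := by
    rintro rfl
    exact hj (by rw [horth]; simp)
  refine absurd hf (not_le.2 ?_)
  rw [hform', hnorm, Finset.mul_sum]
  refine Finset.sum_lt_sum (fun i _ => ?_) ⟨j, Finset.mem_univ _, ?_⟩
  · by_cases hi : i = i₀
    · rw [hi, horth]; simp
    · exact mul_le_mul_of_nonneg_right (hi₀ i hi).le (sq_nonneg _)
  · exact mul_lt_mul_of_pos_right (hi₀ j hjne) (lt_of_le_of_ne (sq_nonneg _) (Ne.symm hj))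

namespace SimpleGraph

variable {V : Type*}

/-- No edge of `G` separates two vertices at distance at most two by distance: if `a`, `b` are
distinct with `dist a b ≤ 2` and `cd` is an edge with `a ≠ d`, `b ≠ c`, then `d` is not closer
to `a` than `c`, or `c` is not closer to `b` than `d`. -/
def NoShortSeparation (G : SimpleGraph V) : Prop :=
  ∀ a b c d : V, G.Adj c d → a ≠ b → G.dist a b ≤ 2 → a ≠ d → b ≠ c →
    G.dist a d < G.dist a c → G.dist b c < G.dist b d → False

open Matrix in
theorem noShortSeparation_of_lambda2_lt [Fintype V] [DecidableEq V] {G : SimpleGraph V}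
    (hconn : G.Connected) (hcard : 2 ≤ Fintype.card V)
    (h : lambda2 (distMatrix G) < (-3 + Real.sqrt 5) / 2) : G.NoShortSeparation := by
  intro a b c d hcd hab hab2 had hbc h1 h2
  refine absurd h (not_lt.2 ?_)
  have hcd1 : G.dist c d = 1 := dist_eq_one_iff_adj.2 hcd
  have hac : G.dist a c = G.dist a d + 1 := by
    have := hconn.dist_triangle (u := a) (v := d) (w := c)
    rw [G.dist_comm (u := d) (v := c), hcd1] at this
    omega
  have hbd : G.dist b d = G.dist b c + 1 := by
    have := hconn.dist_triangle (u := b) (v := c) (w := d)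
    rw [hcd1] at this
    omega
  have hac' : a ≠ c := by rintro rfl; simp at hac
  have hbd' : b ≠ d := by rintro rfl; simp at hbd
  have hcd' : c ≠ d := hcd.ne
  obtain ⟨t, ht0, ht2, hμ⟩ : ∃ t : ℝ, 0 < t ∧ t ^ 2 = t + 1 ∧ (-3 + Real.sqrt 5) / 2 = t - 2 := by
    refine ⟨(1 + Real.sqrt 5) / 2, by positivity, ?_, by ring⟩
    have := Real.sq_sqrt (show (0 : ℝ) ≤ 5 by norm_num)
    linarith
  have ht3 : t < 2 := by nlinarith
  rw [hμ]
  have hA : (distMatrix G).IsHermitian := by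
    ext u v
    simp [distMatrix, G.dist_comm (u := u) (v := v)]
  have hvec : ∀ p q : ℝ, p • (Pi.single a 1 - Pi.single b 1 + t • (Pi.single c 1 - Pi.single d 1)) +
      q • (Pi.single a 1 + Pi.single b 1) = (Pi.single a (p + q) + Pi.single b (q - p) +
        Pi.single c (p * t) + Pi.single d (-(p * t)) : V → ℝ) := by
    intro p q
    ext v
    simp only [Pi.add_apply, Pi.smul_apply, Pi.sub_apply, Pi.single_apply, smul_eq_mul]
    split_ifs <;> ring
  refine le_lambda2_of_le_quadraticForm hA hcard
    (Pi.single a 1 - Pi.single b 1 + t • (Pi.single c 1 - Pi.single d 1))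
    (Pi.single a 1 + Pi.single b 1) (fun p q hpq => ?_) fun p q => ?_
  · rw [hvec] at hpq
    have ha := congrFun hpq a
    have hb := congrFun hpq b
    simp [hab, hab.symm, hac', had, hbc, hbd'] at ha hb
    constructor <;> linarith
  · rw [hvec]
    have hacR : (G.dist a c : ℝ) = G.dist a d + 1 := by exact_mod_cast hac
    have hbdR : (G.dist b d : ℝ) = G.dist b c + 1 := by exact_mod_cast hbd
    have habR : (G.dist a b : ℝ) ≤ 2 := by exact_mod_cast hab2
    have habR0 : (0 : ℝ) ≤ G.dist a b := by positivity
    simp only [add_dotProduct, dotProduct_add, mulVec_add, single_dotProduct,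
      mulVec_single, Pi.smul_apply, op_smul_eq_smul, smul_eq_mul, Matrix.col_apply,
      Pi.single_apply, hab, hab.symm, hac', hac'.symm, had, had.symm, hbc, hbc.symm, hbd',
      hbd'.symm, hcd', hcd'.symm, if_true, if_false, distMatrix, dist_self,
      G.dist_comm (u := b) (v := a), G.dist_comm (u := c) (v := a), G.dist_comm (u := d) (v := a),
      G.dist_comm (u := c) (v := b), G.dist_comm (u := d) (v := b), G.dist_comm (u := d) (v := c),
      hcd1, hacR, hbdR]
    push_cast
    have e1 : 0 ≤ q ^ 2 * (G.dist a b + 2 - t) := by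
      have : 0 ≤ (G.dist a b : ℝ) + 2 - t := by linarith
      positivity
    have e2 : 0 ≤ p ^ 2 * (2 - G.dist a b) := by
      have : 0 ≤ 2 - (G.dist a b : ℝ) := by linarith
      positivity
    have e3 : p ^ 2 * t ^ 2 = p ^ 2 * (t + 1) := by rw [ht2]
    have e4 : p ^ 2 * t ^ 2 * t = p ^ 2 * (2 * t + 1) := by
      rw [mul_assoc, show t ^ 2 * t = 2 * t + 1 by rw [ht2]; linarith]
    linarith

namespace NoShortSeparation

variable {G : SimpleGraph V}

/-- If `a, d, c, b` is a path whose vertices two steps apart are not adjacent, then its endpoints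
are at distance at least three. -/
theorem two_lt_dist (hG : G.NoShortSeparation) (hconn : G.Connected) {a c d b : V}
    (had : G.Adj a d) (hdc : G.Adj d c) (hcb : G.Adj c b)
    (hac : a ≠ c) (hdb : d ≠ b) (hac' : ¬ G.Adj a c) (hdb' : ¬ G.Adj d b) (hab : a ≠ b) :
    2 < G.dist a b := by
  by_contra! h2
  have e1 := hconn.pos_dist_of_ne hac
  have e2 := hconn.pos_dist_of_ne hdb
  have e3 : G.dist a c ≠ 1 := fun h => hac' (dist_eq_one_iff_adj.1 h)
  have e4 : G.dist d b ≠ 1 := fun h => hdb' (dist_eq_one_iff_adj.1 h)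
  have e5 := dist_eq_one_iff_adj.2 had
  have e6 := dist_eq_one_iff_adj.2 hcb
  refine hG a b c d hdc.symm hab h2 had.ne hcb.ne' (by omega) ?_
  rw [G.dist_comm (u := b) (v := c), G.dist_comm (u := b) (v := d)]
  omega

theorem _root_.SimpleGraph.Connected.dist_le_two_of_adj_of_adj (hconn : G.Connected) {a w b : V}
    (h1 : G.Adj a w) (h2 : G.Adj w b) : G.dist a b ≤ 2 := by
  have := hconn.dist_triangle (u := a) (v := w) (w := b)
  rwa [dist_eq_one_iff_adj.2 h1, dist_eq_one_iff_adj.2 h2] at this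

theorem _root_.SimpleGraph.Connected.dist_le_dist_add_one (hconn : G.Connected) (u : V) {v w : V}
    (h : G.Adj v w) : G.dist u v ≤ G.dist u w + 1 := by
  have := hconn.dist_triangle (u := u) (v := w) (w := v)
  rwa [dist_eq_one_iff_adj.2 h.symm] at this

theorem _root_.SimpleGraph.Connected.exists_adj_dist_eq (hconn : G.Connected) {u v : V} {k : ℕ}
    (h : G.dist u v = k + 1) : ∃ x, G.Adj u x ∧ G.dist x v = k := by
  obtain ⟨p, hp⟩ := hconn.exists_walk_length_eq_dist u v
  cases p with
  | nil => simp at h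
  | cons hadj q =>
    refine ⟨_, hadj, ?_⟩
    have e1 := dist_le q
    have e2 := hconn.dist_le_dist_add_one v hadj
    rw [Walk.length_cons] at hp
    rw [G.dist_comm (u := v), G.dist_comm (u := v)] at e2
    omega

/-- The triangle condition. -/
theorem exists_common_neighbor (hG : G.NoShortSeparation) (hconn : G.Connected) {c d : V}
    (hcd : G.Adj c d) {k : ℕ} {u : V} (hc : G.dist u c = k + 1) (hd : G.dist u d = k + 1) :
    ∃ w, G.Adj w c ∧ G.Adj w d ∧ G.dist u w = k := by
  induction k generalizing u with
  | zero => exact ⟨u, dist_eq_one_iff_adj.1 hc, dist_eq_one_iff_adj.1 hd, dist_self⟩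
  | succ k ih =>
    obtain ⟨x, hux, hx⟩ := hconn.exists_adj_dist_eq hc
    obtain ⟨y, huy, hy⟩ := hconn.exists_adj_dist_eq hd
    have lift : ∀ z, G.Adj u z → G.dist z c = k + 1 → G.dist z d = k + 1 →
        ∃ w, G.Adj w c ∧ G.Adj w d ∧ G.dist u w = k + 1 := by
      intro z huz hzc hzd
      obtain ⟨w, hwc, hwd, hw⟩ := ih hzc hzd
      refine ⟨w, hwc, hwd, ?_⟩
      have e1 := hconn.dist_le_dist_add_one u hwc.symm
      have e2 := hconn.dist_le_dist_add_one w huz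
      rw [G.dist_comm (u := w), G.dist_comm (u := w)] at e2
      omega
    by_cases hxd : G.dist x d = k + 1
    · exact lift x hux hx hxd
    by_cases hyc : G.dist y c = k + 1
    · exact lift y huy hyc hy
    have e1 := hconn.dist_le_dist_add_one d hux
    have e2 := hconn.dist_le_dist_add_one c huy
    rw [G.dist_comm (u := d), G.dist_comm (u := d)] at e1
    rw [G.dist_comm (u := c), G.dist_comm (u := c)] at e2
    refine (hG x y d c hcd.symm ?_ (hconn.dist_le_two_of_adj_of_adj hux.symm huy) ?_ ?_
      (by omega) (by omega)).elim
    · rintro rfl; omega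
    · rintro rfl; simp at hx
    · rintro rfl; simp at hy

/-- The interval neighbourhood condition: neighbours of `z` one step closer to `u` form
a clique. -/
theorem eq_or_adj (hG : G.NoShortSeparation) (hconn : G.Connected) {k : ℕ} {u z c d : V}
    (hz : G.dist u z = k + 1) (hzc : G.Adj z c) (hzd : G.Adj z d)
    (hc : G.dist u c = k) (hd : G.dist u d = k) : c = d ∨ G.Adj c d := by
  induction k generalizing u z c d with
  | zero =>
    exact Or.inl ((hconn.dist_eq_zero_iff.1 hc).symm.trans (hconn.dist_eq_zero_iff.1 hd))
  | succ k ih =>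
    by_contra! hcd
    obtain ⟨hne, hnadj⟩ := hcd
    have hcd2 := hconn.dist_le_two_of_adj_of_adj hzc.symm hzd
    have level_ne : ∀ {v w : V}, G.dist u v ≠ G.dist u w → v ≠ w := by
      rintro v _ h rfl; exact h rfl
    obtain ⟨y, huy, hy⟩ := hconn.exists_adj_dist_eq hd
    have step : ∀ v, G.dist u v ≤ G.dist y v + 1 ∧ G.dist y v ≤ G.dist u v + 1 := by
      intro v
      have e1 := hconn.dist_le_dist_add_one v huy
      have e2 := hconn.dist_le_dist_add_one v huy.symm
      rw [G.dist_comm (u := v), G.dist_comm (u := v)] at e1 e2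
      exact ⟨e1, e2⟩
    have hyz : G.dist y z = k + 1 := by
      have := hconn.dist_le_dist_add_one y hzd
      have := (step z).1
      omega
    by_cases hyc : G.dist y c = k
    · exact (ih hyz hzc hzd hyc hy).elim hne hnadj
    by_cases hyc' : G.dist y c = k + 1
    · obtain ⟨w, hwc, hwz, hyw⟩ := hG.exists_common_neighbor hconn hzc.symm hyc' hyz
      rcases ih hyz hwz.symm hzd hyw hy with rfl | hwd
      · exact hnadj hwc.symm
      have huw : G.dist u w = k + 1 := by
        have := (step w).1
        have := hconn.dist_le_dist_add_one u hwz.symm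
        omega
      obtain ⟨q, hqc, hqw, hq⟩ := hG.exists_common_neighbor hconn hwc.symm hc huw
      obtain ⟨p, hpw, hpd, hp⟩ := hG.exists_common_neighbor hconn hwd huw hd
      have far : ∀ {v : V}, G.dist u v = k → v ≠ z ∧ ¬ G.Adj v z := by
        intro v hv
        refine ⟨level_ne (by omega), fun h => ?_⟩
        have := hconn.dist_le_dist_add_one u h.symm
        omega
      have square : ∀ {v : V}, G.dist u v = k → G.Adj v c → G.Adj v d → False := by
        intro v hv hvc hvd
        have := hG.two_lt_dist hconn hvc hzc.symm hzd (far hv).1 hne (far hv).2 hnadj hvd.ne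
        rw [dist_eq_one_iff_adj.2 hvd] at this
        omega
      rcases ih huw hqw.symm hpw.symm hq hp with rfl | hqp
      · exact square hq hqc hpd
      · have := hG.two_lt_dist hconn hqc.symm hqp hpd (level_ne (by omega)) (level_ne (by omega))
          (fun h => square hp h.symm hpd) (fun h => square hq hqc h) hne
        omega
    · have e1 := (step c)
      have e3 : G.dist d z = 1 := dist_eq_one_iff_adj.2 hzd.symm
      exact hG u y z c hzc huy.ne (by rw [dist_eq_one_iff_adj.2 huy]; omega)
        (by rintro rfl; simp at hc) (by rintro rfl; simp at hyz) (by omega) (by omega)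

/-- There is no chordless closed sequence of length at least four. -/
theorem not_chordless (hG : G.NoShortSeparation) (hconn : G.Connected) {n : ℕ} (hn : 1 ≤ n)
    (z : ℕ → V) (hclosed : z n = z 0) (hadj : ∀ i < n, G.Adj (z i) (z (i + 1)))
    (hne2 : ∀ i, i + 2 ≤ n → z i ≠ z (i + 2)) (hnadj2 : ∀ i, i + 2 ≤ n → ¬ G.Adj (z i) (z (i + 2)))
    (hne3 : ∀ i, i + 3 ≤ n → z i ≠ z (i + 3)) : False := by
  have hlevel : ∀ i < n, G.dist (z 0) (z i) ≤ G.dist (z 0) (z (i + 1)) + 1 ∧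
      G.dist (z 0) (z (i + 1)) ≤ G.dist (z 0) (z i) + 1 := fun i hi =>
    ⟨hconn.dist_le_dist_add_one _ (hadj i hi), hconn.dist_le_dist_add_one _ (hadj i hi).symm⟩
  have hthree : ∀ i, i + 3 ≤ n → 2 < G.dist (z i) (z (i + 3)) := fun i hi =>
    hG.two_lt_dist hconn (hadj i (by omega)) (hadj (i + 1) (by omega)) (hadj (i + 2) (by omega))
      (hne2 i (by omega)) (hne2 (i + 1) (by omega)) (hnadj2 i (by omega))
      (hnadj2 (i + 1) (by omega)) (hne3 i hi)
  have hcommon : ∀ i w, i + 3 ≤ n → G.Adj w (z i) → ¬ G.Adj w (z (i + 3)) := fun i w hi h1 h2 =>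
    absurd (hthree i hi) (not_lt.2 (hconn.dist_le_two_of_adj_of_adj h1.symm h2))
  -- the first vertex of maximal level
  obtain ⟨m, hm, hmmax⟩ := Finset.exists_max_image (Finset.range (n + 1))
    (fun i => G.dist (z 0) (z i)) ⟨0, by simp⟩
  have hM : ∃ i, i ≤ n ∧ ∀ j ≤ n, G.dist (z 0) (z j) ≤ G.dist (z 0) (z i) :=
    ⟨m, by simpa [Nat.lt_succ_iff] using hm, fun j hj => hmmax j (by simp; omega)⟩
  classical
  obtain ⟨hin, himax⟩ := Nat.find_spec hM
  have hmin : ∀ j, j < Nat.find hM → G.dist (z 0) (z j) < G.dist (z 0) (z (Nat.find hM)) := by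
    intro j hj
    by_contra! hle
    exact Nat.find_min hM hj ⟨by omega, fun l hl => (himax l hl).trans hle⟩
  set i := Nat.find hM
  have hpos : 0 < G.dist (z 0) (z i) := by
    have e1 := himax 1 hn
    have e2 := dist_eq_one_iff_adj.2 (hadj 0 hn)
    rw [zero_add] at e2
    omega
  obtain ⟨k, hk⟩ : ∃ k, G.dist (z 0) (z i) = k + 1 := ⟨_, (Nat.succ_pred_eq_of_pos hpos).symm⟩
  rw [hk] at himax hmin
  have hi0 : i ≠ 0 := by
    intro h
    rw [h] at hk
    simp at hk
  obtain ⟨i', hi'⟩ := Nat.exists_eq_succ_of_ne_zero hi0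
  -- all later vertices have maximal level
  have key : ∀ t, i' + t + 1 ≤ n → G.dist (z 0) (z (i' + t + 1)) = k + 1 ∧
      ∃ w, G.dist (z 0) w = k ∧ G.Adj w (z (i' + t + 1)) ∧
        (w = z (i' + t) ∨ (G.Adj w (z (i' + t)) ∧ ∃ s, s + 1 = i' + t ∧ G.Adj w (z s))) := by
    intro t
    induction t with
    | zero =>
      intro hle
      have e1 := hmin i' (by omega)
      have e2 := (hlevel i' (by omega)).2
      have e3 : z (i' + 1) = z i := by rw [hi']
      rw [e3, hk] at e2
      exact ⟨by rw [add_zero, e3, hk], z i', by omega, hadj i' (by omega), Or.inl rfl⟩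
    | succ t ih =>
      intro hle
      obtain ⟨hlev, w, hw, hwj, hcase⟩ := ih (by omega)
      rw [show i' + (t + 1) = i' + t + 1 by ring] at hle ⊢
      generalize i' + t = j at *
      have hjj := hadj (j + 1) (by omega)
      have hmaxj := himax (j + 1 + 1) (by omega)
      have hlevj := (hlevel (j + 1) (by omega)).1
      by_cases hk' : G.dist (z 0) (z (j + 1 + 1)) = k
      · exfalso
        have hadj_or := hG.eq_or_adj hconn hlev hwj.symm hjj hw hk'
        rcases hcase with rfl | ⟨hwj', s, rfl, hws⟩
        · exact hadj_or.elim (hne2 j (by omega)) (hnadj2 j (by omega))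
        · rcases hadj_or with rfl | h
          · exact hnadj2 (s + 1) (by omega) hwj'.symm
          · exact hcommon s w (by omega) hws h
      have hlev' : G.dist (z 0) (z (j + 1 + 1)) = k + 1 := by omega
      refine ⟨hlev', ?_⟩
      obtain ⟨w', hw'j, hw'j', hw'⟩ := hG.exists_common_neighbor hconn hjj hlev hlev'
      have hadj_or := hG.eq_or_adj hconn hlev hwj.symm hw'j.symm hw hw'
      refine ⟨w', hw', hw'j', Or.inr ⟨hw'j, j, rfl, ?_⟩⟩
      rcases hcase with rfl | ⟨hwj', s, rfl, hws⟩
      · rcases hadj_or with rfl | h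
        · exact (hnadj2 j (by omega) hw'j').elim
        · exact h.symm
      · rcases hadj_or with rfl | h
        · exact (hcommon s w (by omega) hws hw'j').elim
        by_contra hcon
        have := hG.two_lt_dist hconn hwj'.symm h hw'j'
          (fun e => hnadj2 (s + 1) (by omega) (e ▸ hw'j'))
          (fun e => hnadj2 (s + 1) (by omega) (by
            have := hwj'.symm
            rwa [e] at this))
          (fun e => hcon e.symm) (hcommon s w (by omega) hws) (hne2 (s + 1) (by omega))
        have := hconn.dist_le_two_of_adj_of_adj (hadj (s + 1) (by omega)) hjj
        omega
  have hend := (key (n - i' - 1) (by omega)).1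
  rw [show i' + (n - i' - 1) + 1 = n by omega, hclosed] at hend
  simp at hend

theorem chordal (hG : G.NoShortSeparation) (hconn : G.Connected) : G.Chordal := by
  intro u w hw hlen
  by_contra! hcon
  have hinj := hw.getVert_injOn
  have hinj' := hw.getVert_injOn'
  have hne : ∀ i j, i < j → j ≤ w.length → j - i < w.length → w.getVert i ≠ w.getVert j := by
    intro i j hij hj hlt heq
    by_cases hi : i = 0
    · have := hinj' (x₁ := i) (x₂ := j) (by simp; omega) (by simp; omega) heq
      omega
    · have := hinj (x₁ := i) (x₂ := j) (by simp; omega) (by simp; omega) heq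
      omega
  refine hG.not_chordless hconn (n := w.length) (by omega) w.getVert (by simp)
    (fun i hi => w.adj_getVert_succ hi) (fun i hi => hne _ _ (by omega) hi (by omega))
    (fun i hi hadj => ?_) (fun i hi => hne _ _ (by omega) hi (by omega))
  have hmem := hcon _ _ (w.getVert_mem_support i) (w.getVert_mem_support (i + 2)) hadj
  obtain ⟨j, hj, hj'⟩ := List.mem_iff_getElem.1 hmem
  rw [Walk.length_edges] at hj
  rw [Walk.getElem_edges] at hj'
  have key : ∀ a b, a ≤ w.length → b ≤ w.length → w.getVert a = w.getVert b →
      a = b ∨ (a = 0 ∧ b = w.length) ∨ (b = 0 ∧ a = w.length) := by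
    intro a b ha hb h
    rcases lt_trichotomy a b with hab | hab | hab
    · have := mt (hne a b hab hb) (by simpa using h)
      omega
    · exact Or.inl hab
    · have := mt (hne b a hab ha) (by simpa using h.symm)
      omega
  rcases Sym2.eq_iff.1 hj' with ⟨h1, h2⟩ | ⟨h1, h2⟩
  · have := key _ _ (by omega) (by omega) h1
    have := key _ _ (by omega) (by omega) h2
    omega
  · have := key _ _ (by omega) (by omega) h1
    have := key _ _ (by omega) (by omega) h2
    omega

end NoShortSeparation

end SimpleGraph

theorem chordal_of_lambda2_lt (V : Type*) [Fintype V] [DecidableEq V]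
    (G : SimpleGraph V) (hconn : G.Connected) (hcard : 2 ≤ Fintype.card V)
    (h : lambda2 (distMatrix G) < (-3 + Real.sqrt 5) / 2) : G.Chordal :=
  (SimpleGraph.noShortSeparation_of_lambda2_lt hconn hcard h).chordal hconn
end

section
/- If a connected graph G has second largest distance eigenvalue less than -1/2, then G is chordal. -/
open Real

open Matrix in
/-- If the second largest eigenvalue is below `c`, all eigenvalues but one are below `c`. -/
theorem exists_forall_ne_eigenvalues_lt {V : Type*} [Fintype V] [DecidableEq V]
    {A : Matrix V V ℝ} (hA : A.IsHermitian) (hcard : 2 ≤ Fintype.card V) {c : ℝ}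
    (h : lambda2 A < c) : ∃ j, ∀ i, i ≠ j → hA.eigenvalues i < c := by
  have : Nonempty V := Fintype.card_pos_iff.mp (by omega)
  by_contra! hne
  obtain ⟨i, -, hi⟩ := hne (Classical.arbitrary V)
  obtain ⟨j, hji, hj⟩ := hne i
  simp only [lambda2, kthLargestEig, dif_pos hA] at h
  set s := Finset.univ.val.map hA.eigenvalues with hs
  set L := s.sort (· ≤ ·) with hL
  have hlen : L.length = Fintype.card V := by simp [hL, hs]
  have hlt : Fintype.card V - 2 < L.length := by omega
  rw [List.getD_eq_getElem _ _ hlt] at h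
  have hpw : L.Pairwise (· ≤ ·) := s.pairwise_sort (· ≤ ·)
  have hcount : L.countP (c ≤ ·) ≤ 1 := by
    rw [← List.take_append_drop (Fintype.card V - 1) L, List.countP_append]
    have htake : (L.take (Fintype.card V - 1)).countP (c ≤ ·) = 0 := by
      rw [List.countP_eq_zero]
      intro a ha
      obtain ⟨k, hk, rfl⟩ := List.mem_take_iff_getElem.mp ha
      have hle : L[k] ≤ L[Fintype.card V - 2] := by
        rcases (show k ≤ Fintype.card V - 2 by omega).eq_or_lt with rfl | hlt'
        · rfl
        · exact List.pairwise_iff_getElem.mp hpw _ _ _ _ hlt'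
      simpa using hle.trans_lt h
    have hdrop : (L.drop (Fintype.card V - 1)).countP (c ≤ ·) ≤ 1 :=
      List.countP_le_length.trans (by rw [List.length_drop]; omega)
    omega
  have hcard' : (Finset.univ.filter fun k => c ≤ hA.eigenvalues k).card ≤ 1 := by
    have hsc : s.countP (c ≤ ·) ≤ 1 := by
      rw [← s.sort_eq (· ≤ ·), Multiset.coe_countP]
      exact hcount
    rwa [hs, Multiset.countP_map] at hsc
  exact hji (Finset.card_le_one.mp hcard' _ (by simpa using hj) _ (by simpa using hi))

open Matrix in
theorem Matrix.IsHermitian.dotProduct_mulVec_eq_sum_eigenvalues {V : Type*} [Fintype V]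
    [DecidableEq V] {A : Matrix V V ℝ} (hA : A.IsHermitian) (z : V → ℝ) :
    z ⬝ᵥ A *ᵥ z = ∑ i, hA.eigenvalues i * (⇑(hA.eigenvectorBasis i) ⬝ᵥ z) ^ 2 := by
  have hT : Aᵀ = A := hA
  have h := hA.eigenvectorBasis.sum_inner_mul_inner (WithLp.toLp 2 z) (WithLp.toLp 2 (A *ᵥ z))
  simp only [EuclideanSpace.inner_eq_star_dotProduct, star_trivial] at h
  rw [dotProduct_comm, ← h]
  refine Finset.sum_congr rfl fun i _ => ?_
  have : (A *ᵥ z) ⬝ᵥ ⇑(hA.eigenvectorBasis i)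
      = hA.eigenvalues i * (⇑(hA.eigenvectorBasis i) ⬝ᵥ z) := by
    rw [dotProduct_comm, dotProduct_mulVec, ← mulVec_transpose, hT, hA.mulVec_eigenvectorBasis,
      smul_dotProduct, smul_eq_mul]
  rw [this]
  ring

open Matrix in
theorem Matrix.IsHermitian.dotProduct_self_eq_sum {V : Type*} [Fintype V]
    [DecidableEq V] {A : Matrix V V ℝ} (hA : A.IsHermitian) (z : V → ℝ) :
    z ⬝ᵥ z = ∑ i, (⇑(hA.eigenvectorBasis i) ⬝ᵥ z) ^ 2 := by
  have h := hA.eigenvectorBasis.sum_inner_mul_inner (WithLp.toLp 2 z) (WithLp.toLp 2 z)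
  simp only [EuclideanSpace.inner_eq_star_dotProduct, star_trivial] at h
  rw [← h]
  refine Finset.sum_congr rfl fun i _ => ?_
  rw [dotProduct_comm z, sq]

open Matrix in
/-- A plane on which the quadratic form of `A - c` is nonnegative forces `c ≤ lambda2 A`. -/
theorem le_lambda2_of_linearIndependent {V : Type*} [Fintype V] [DecidableEq V]
    {A : Matrix V V ℝ} (hA : A.IsHermitian) (hcard : 2 ≤ Fintype.card V) {c : ℝ} {x y : V → ℝ}
    (hxy : LinearIndependent ℝ ![x, y]) (hx : c * (x ⬝ᵥ x) ≤ x ⬝ᵥ A *ᵥ x)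
    (hy : c * (y ⬝ᵥ y) ≤ y ⬝ᵥ A *ᵥ y) (horth : x ⬝ᵥ A *ᵥ y = c * (x ⬝ᵥ y)) :
    c ≤ lambda2 A := by
  by_contra! hlt
  have hT : Aᵀ = A := hA
  obtain ⟨j, hj⟩ := exists_forall_ne_eigenvalues_lt hA hcard hlt
  set e : V → V → ℝ := fun i => ⇑(hA.eigenvectorBasis i) with he
  rw [LinearIndependent.pair_iff] at hxy
  obtain ⟨α, β, hne, hz⟩ : ∃ α β : ℝ, α • x + β • y ≠ 0 ∧ e j ⬝ᵥ (α • x + β • y) = 0 := by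
    by_cases h0 : e j ⬝ᵥ x = 0
    · refine ⟨1, 0, fun h => ?_, by simp [h0]⟩
      simpa using (hxy _ _ h).1
    · refine ⟨e j ⬝ᵥ y, -(e j ⬝ᵥ x), fun h => h0 (by simpa using (hxy _ _ h).2), ?_⟩
      simp only [dotProduct_add, dotProduct_smul, smul_eq_mul]
      ring
  set z := α • x + β • y with hzdef
  have hyx : y ⬝ᵥ A *ᵥ x = x ⬝ᵥ A *ᵥ y := by
    rw [dotProduct_mulVec, ← mulVec_transpose, hT, dotProduct_comm]
  have hge : c * (z ⬝ᵥ z) ≤ z ⬝ᵥ A *ᵥ z := by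
    simp only [hzdef, mulVec_add, mulVec_smul, dotProduct_add, add_dotProduct, smul_dotProduct,
      dotProduct_smul, smul_eq_mul, hyx, horth, dotProduct_comm y x]
    nlinarith [mul_le_mul_of_nonneg_left hx (sq_nonneg α),
      mul_le_mul_of_nonneg_left hy (sq_nonneg β)]
  have hpos : 0 < z ⬝ᵥ z := by
    refine lt_of_le_of_ne (Finset.sum_nonneg fun i _ => mul_self_nonneg _) fun h => hne ?_
    exact dotProduct_self_eq_zero.mp h.symm
  rw [hA.dotProduct_self_eq_sum] at hpos
  rw [hA.dotProduct_mulVec_eq_sum_eigenvalues, hA.dotProduct_self_eq_sum, Finset.mul_sum] at hge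
  obtain ⟨k, -, hk⟩ := Finset.exists_ne_zero_of_sum_ne_zero hpos.ne'
  refine hge.not_gt (Finset.sum_lt_sum (fun i _ => ?_) ⟨k, Finset.mem_univ k, ?_⟩)
  · by_cases hij : i = j
    · subst hij
      have : ⇑(hA.eigenvectorBasis i) ⬝ᵥ z = 0 := hz
      simp [this]
    · exact mul_le_mul_of_nonneg_right (hj i hij).le (sq_nonneg _)
  · have hkj : k ≠ j := by
      rintro rfl
      exact hk (by have : ⇑(hA.eigenvectorBasis k) ⬝ᵥ z = 0 := hz; simp [this])
    exact mul_lt_mul_of_pos_right (hj k hkj) (lt_of_le_of_ne (sq_nonneg _) hk.symm)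

theorem distMatrix_isHermitian {V : Type*} [Fintype V] (G : SimpleGraph V) :
    (distMatrix G).IsHermitian := by
  ext u v
  simp [distMatrix, SimpleGraph.dist_comm]

open Matrix in
/-- If `lambda2 (distMatrix G) < -1/2`, then two geodesics `p, q, …, r` and `q, …, r, t`, with
`p q` and `r t` edges, glue to a geodesic from `p` to `t`. -/
theorem dist_gt_of_lambda2_lt_neg_half {V : Type*} [Fintype V] [DecidableEq V]
    {G : SimpleGraph V} (hcard : 2 ≤ Fintype.card V)
    (h : lambda2 (distMatrix G) < -1/2) {p q r t : V} {m : ℕ} (hm : 1 ≤ m)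
    (hpq : G.dist p q = 1) (hrt : G.dist r t = 1) (hqr : G.dist q r = m)
    (hpr : G.dist p r = m + 1) (hqt : G.dist q t = m + 1) : m + 1 < G.dist p t := by
  by_contra! hD
  have npq : p ≠ q := by rintro rfl; simp at hpq
  have nrt : r ≠ t := by rintro rfl; simp at hrt
  have nqr : q ≠ r := by rintro rfl; simp at hqr; omega
  have npr : p ≠ r := by rintro rfl; simp at hpr
  have nqt : q ≠ t := by rintro rfl; simp at hqt
  have npt : p ≠ t := by rintro rfl; rw [G.dist_comm] at hrt; omega
  set D : ℝ := (G.dist p t : ℝ) with hDdef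
  have hD' : D ≤ m + 1 := by rw [hDdef]; exact_mod_cast hD
  have hD0 : 0 ≤ D := Nat.cast_nonneg _
  have hm' : (1 : ℝ) ≤ m := by exact_mod_cast hm
  set a : ℝ := 2 * m with ha
  set b : ℝ := 2 * m + 1 with hb
  set A := distMatrix G with hAdef
  have eself : ∀ u, A u u = 0 := fun u => by simp [hAdef, distMatrix]
  have esymm : ∀ u v, A u v = A v u := fun u v => by simp [hAdef, distMatrix, G.dist_comm]
  have epq : A p q = 1 := by simp [hAdef, distMatrix, hpq]
  have ert : A r t = 1 := by simp [hAdef, distMatrix, hrt]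
  have eqr : A q r = m := by simp [hAdef, distMatrix, hqr]
  have epr : A p r = m + 1 := by simp [hAdef, distMatrix, hpr]
  have eqt : A q t = m + 1 := by simp [hAdef, distMatrix, hqt]
  have ept : A p t = D := rfl
  have esingle : ∀ u v : V, (Pi.single u (1 : ℝ) : V → ℝ) ⬝ᵥ A *ᵥ Pi.single v 1 = A u v := by
    intro u v
    simp
  have esingle' : ∀ u v : V, (Pi.single u (1 : ℝ) : V → ℝ) ⬝ᵥ Pi.single v (1 : ℝ)
      = if u = v then 1 else 0 := by
    intro u v
    simp [Pi.single_apply, eq_comm]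
  let x : V → ℝ := a • Pi.single p 1 - b • Pi.single q 1 + b • Pi.single r 1 - a • Pi.single t 1
  let y : V → ℝ := Pi.single p 1 + Pi.single t 1
  refine h.not_ge (le_lambda2_of_linearIndependent (distMatrix_isHermitian G) hcard
    (x := x) (y := y) ?_ ?_ ?_ ?_)
  · rw [LinearIndependent.pair_iff]
    intro α β h0
    have hq := congrFun h0 q
    have hp := congrFun h0 p
    simp [x, y, npq.symm, nqr, nqt] at hq
    simp [x, y, npq, npr, npt] at hp
    have hα : α = 0 := hq.resolve_right (by positivity)
    subst hα
    simpa using hp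
  · simp only [x, mulVec_add, mulVec_sub, mulVec_smul, dotProduct_add, add_dotProduct,
      dotProduct_sub, sub_dotProduct, smul_dotProduct, dotProduct_smul, smul_eq_mul, ← hAdef,
      esingle, esingle', eself, epq, ert, eqr, epr, eqt, ept, esymm q p, esymm t r, esymm r q,
      esymm r p, esymm t q, esymm t p, npq, nrt, nqr, npr, nqt, npt, npq.symm, nrt.symm, nqr.symm,
      npr.symm, nqt.symm, npt.symm, if_true, if_false]
    rw [hb, ha]
    nlinarith [mul_le_mul_of_nonneg_left hD' (sq_nonneg (m : ℝ))]
  · simp only [y, mulVec_add, dotProduct_add, add_dotProduct, ← hAdef,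
      esingle, esingle', eself, ept, esymm t p, npt, npt.symm, if_true, if_false]
    linarith
  · simp only [x, y, mulVec_add, dotProduct_add, add_dotProduct,
      sub_dotProduct, smul_dotProduct, smul_eq_mul, ← hAdef,
      esingle, esingle', eself, epq, ert, epr, eqt, ept, esymm q p, esymm r p, esymm t p, nrt,
      nqt, npt, npq.symm, npr.symm, npt.symm, if_true, if_false]
    ring

theorem chordal_of_lambda2_lt_neg_half {V : Type*} [Fintype V] [DecidableEq V]
    (G : SimpleGraph V) (hconn : G.Connected) (hcard : 2 ≤ Fintype.card V)
    (h : lambda2 (distMatrix G) < -1/2) : G.Chordal := by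
  intro u w hw hlen
  by_contra! hchord
  have hinj : ∀ i j, i ≤ w.length - 1 → j ≤ w.length - 1 → w.getVert i = w.getVert j → i = j :=
    fun i j hi hj => fun hij => hw.getVert_injOn' hi hj hij
  have hnonadj : ∀ i, i + 2 ≤ w.length - 1 → ¬ G.Adj (w.getVert i) (w.getVert (i + 2)) := by
    intro i hi hadj
    have hmem := hchord _ _ (w.getVert_mem_support i) (w.getVert_mem_support (i + 2)) hadj
    obtain ⟨k, hk, heq⟩ := w.mk_mem_edges_iff_exists.mp hmem
    have hlast : k + 1 = w.length → w.getVert (k + 1) = w.getVert 0 := by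
      rintro hk'
      rw [hk', w.getVert_length, w.getVert_zero]
    rw [Sym2.eq_iff] at heq
    rcases heq with ⟨h₁, h₂⟩ | ⟨h₁, h₂⟩ <;>
    · have hki := hinj _ _ (by omega) (by omega) h₁
      rcases (show k + 1 = w.length ∨ k + 1 ≤ w.length - 1 by omega) with hk' | hk'
      · rw [hlast hk'] at h₂
        have := hinj _ _ (by omega) (by omega) h₂
        omega
      · have := hinj _ _ (by omega) (by omega) h₂
        omega
  have hstep : ∀ i, i < w.length → G.dist (w.getVert i) (w.getVert (i + 1)) = 1 :=
    fun i hi => SimpleGraph.dist_eq_one_iff_adj.mpr (w.adj_getVert_succ hi)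
  have hdist : ∀ l i, i + l ≤ w.length - 1 → G.dist (w.getVert i) (w.getVert (i + l)) = l := by
    intro l
    induction l using Nat.strong_induction_on with
    | _ l ih =>
      intro i hi
      match l with
      | 0 => simp
      | 1 => exact hstep i (by omega)
      | m + 2 =>
        have hle : G.dist (w.getVert i) (w.getVert (i + (m + 2))) ≤ m + 2 := by
          have htri := hconn.dist_triangle (u := w.getVert i) (v := w.getVert (i + (m + 1)))
            (w := w.getVert (i + (m + 2)))
          have h₁ := ih (m + 1) (by omega) i (by omega)
          have h₂ := hstep (i + (m + 1)) (by omega)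
          rw [show i + (m + 1) + 1 = i + (m + 2) by ring] at h₂
          omega
        refine le_antisymm hle ?_
        rcases Nat.eq_zero_or_pos m with rfl | hm
        · exact hconn.one_lt_dist_of_ne_of_not_adj
            (fun heq => by have := hinj _ _ (by omega) hi heq; omega) (hnonadj i hi)
        · have hlast := hstep (i + (m + 1)) (by omega)
          have hmid := ih m (by omega) (i + 1) (by omega)
          have hright := ih (m + 1) (by omega) (i + 1) (by omega)
          rw [show i + (m + 1) + 1 = i + (m + 2) by ring] at hlast
          rw [show i + 1 + m = i + (m + 1) by ring] at hmid
          rw [show i + 1 + (m + 1) = i + (m + 2) by ring] at hright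
          exact dist_gt_of_lambda2_lt_neg_half hcard h hm (hstep i (by omega)) hlast hmid
            (ih (m + 1) (by omega) i (by omega)) hright
  have hfar := hdist (w.length - 1) 0 (by omega)
  have hclose := hstep (w.length - 1) (by omega)
  rw [Nat.sub_add_cancel (by omega), w.getVert_length, SimpleGraph.dist_comm] at hclose
  rw [w.getVert_zero, zero_add] at hfar
  omega
end

section
/- For the cycle Cₙ on n ≥ 3 vertices, the second largest distance eigenvalue equals 0 if n is even, and equals -(1/4)·sec²(π/n) if n is odd. -/
open Real

lemma kthLargestEig_two_eq {V : Type*} [Fintype V] [DecidableEq V] {A : Matrix V V ℝ}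
    (hA : A.IsHermitian) {i₀ i₁ : V} (hne : i₁ ≠ i₀)
    (hle : hA.eigenvalues i₁ ≤ hA.eigenvalues i₀)
    (hmax : ∀ i ≠ i₀, hA.eigenvalues i ≤ hA.eigenvalues i₁) :
    kthLargestEig 2 A = hA.eigenvalues i₁ := by
  classical
  set f := hA.eigenvalues
  set S : Finset V := (Finset.univ.erase i₀).erase i₁
  have hmem : i₁ ∈ (Finset.univ.erase i₀ : Finset V) := by simp [hne]
  have hval : (Finset.univ.val.map f : Multiset ℝ) = f i₀ ::ₘ f i₁ ::ₘ S.val.map f := by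
    rw [← Multiset.map_cons, ← Multiset.map_cons]
    congr 1
    rw [← Finset.insert_val_of_notMem (by simp [S]), Finset.insert_erase hmem,
      ← Finset.insert_val_of_notMem (by simp), Finset.insert_erase (Finset.mem_univ _)]
  have hcard : S.card + 2 = Fintype.card V := by
    rw [Finset.card_erase_of_mem hmem, Finset.card_erase_of_mem (Finset.mem_univ _),
      Finset.card_univ]
    have : 1 < Fintype.card V := Fintype.one_lt_card_iff.2 ⟨_, _, hne⟩
    omega
  have hsort : (Finset.univ.val.map f).sort (· ≤ ·)
      = (S.val.map f).sort (· ≤ ·) ++ [f i₁, f i₀] := by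
    refine List.Perm.eq_of_pairwise' (r := (· ≤ ·)) (Multiset.pairwise_sort _ _) ?_ ?_
    · rw [List.pairwise_append]
      refine ⟨Multiset.pairwise_sort _ _, by simpa using hle, ?_⟩
      have hS : ∀ a ∈ (S.val.map f).sort (· ≤ ·), a ≤ f i₁ := by
        intro a ha
        rw [Multiset.mem_sort, Multiset.mem_map] at ha
        obtain ⟨i, hi, rfl⟩ := ha
        have hi' : i ∈ S := hi
        exact hmax i (by simp [S] at hi'; tauto)
      intro a ha b hb
      simp only [List.mem_cons, List.not_mem_nil, or_false] at hb
      rcases hb with rfl | rfl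
      · exact hS a ha
      · exact (hS a ha).trans hle
    · rw [← Multiset.coe_eq_coe, ← Multiset.coe_add, Multiset.sort_eq, Multiset.sort_eq, hval,
        add_comm, Multiset.cons_swap, ← Multiset.cons_coe, ← Multiset.cons_coe, Multiset.coe_nil,
        Multiset.cons_add, Multiset.cons_add, zero_add]
  have hlen : Fintype.card V - 2 = ((S.val.map f).sort (· ≤ ·)).length := by
    simp; omega
  rw [kthLargestEig, dif_pos hA]
  change ((Finset.univ.val.map f).sort (· ≤ ·)).getD _ 0 = _
  rw [hsort, hlen, List.getD_append_right _ _ _ _ le_rfl]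
  simp

lemma Matrix.IsHermitian.exists_eigenvalues_eq {V : Type*} [Fintype V] [DecidableEq V]
    {A : Matrix V V ℝ} (hA : A.IsHermitian) {v : V → ℝ} {μ : ℝ} (hv : v ≠ 0)
    (h : A.mulVec v = μ • v) : ∃ i, hA.eigenvalues i = μ := by
  have : μ ∈ spectrum ℝ A := by
    rw [← Matrix.spectrum_toLin']
    refine (Module.End.hasEigenvalue_of_hasEigenvector (x := v) ⟨?_, hv⟩).mem_spectrum
    rw [Module.End.mem_eigenspace_iff, Matrix.toLin'_apply, h]
  rwa [hA.spectrum_real_eq_range_eigenvalues] at this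

namespace ZMod

variable {N : ℕ}

/-- The circular distance from `x` to `0`. -/
noncomputable def circNorm (x : ZMod N) : ℝ := (x.valMinAbs.natAbs : ℝ)

lemma circNorm_neg (x : ZMod N) : circNorm (-x) = circNorm x := by
  simp [circNorm]

lemma two_ne_zero_of_three_le (hN : 3 ≤ N) : (2 : ZMod N) ≠ 0 := by
  rw [← Nat.cast_two, Ne, natCast_eq_zero_iff]
  exact fun h => absurd (Nat.le_of_dvd two_pos h) (by omega)

variable [NeZero N]

/-- The matrix of circular distances. -/
noncomputable def circMatrix (N : ℕ) [NeZero N] : Matrix (ZMod N) (ZMod N) ℝ :=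
  fun u v => circNorm (u - v)

lemma circMatrix_isHermitian : (circMatrix N).IsHermitian := by
  ext u v
  simp only [circMatrix, Matrix.conjTranspose_apply, star_trivial]
  rw [← circNorm_neg, neg_sub]

/-- The Fourier coefficient of the circular distance. -/
noncomputable def circEig (j : ZMod N) : ℂ := ∑ x : ZMod N, stdAddChar (-(x * j)) * (circNorm x : ℂ)

lemma sum_stdAddChar_mulVec (v : ZMod N → ℝ) (j : ZMod N) :
    ∑ u, stdAddChar (-(u * j)) * (((circMatrix N).mulVec v u : ℝ) : ℂ)
      = circEig j * ∑ w, stdAddChar (-(w * j)) * (v w : ℂ) := by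
  simp only [Matrix.mulVec, dotProduct, circMatrix, circEig, Complex.ofReal_sum,
    Complex.ofReal_mul, Finset.mul_sum, Finset.sum_mul]
  rw [Finset.sum_comm]
  refine Finset.sum_congr rfl fun w _ => ?_
  refine Fintype.sum_equiv (Equiv.subRight w) _ _ fun u => ?_
  have : -(u * j) = -((u - w) * j) + -(w * j) := by ring
  rw [this, AddChar.map_add_eq_mul]
  simp only [Equiv.subRight_apply]
  ring

lemma conj_stdAddChar (x : ZMod N) :
    (starRingEnd ℂ) (stdAddChar x) = stdAddChar (-x) := by
  rw [AddChar.map_neg_eq_conj]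

lemma circMatrix_mulVec_re {j : ZMod N} {μ : ℝ} (h : circEig j = μ) :
    (circMatrix N).mulVec (fun w => (stdAddChar (w * j)).re)
      = μ • fun w => (stdAddChar (w * j)).re := by
  ext u
  have key : ∑ w, (circNorm (u - w) : ℂ) * stdAddChar (w * j) = μ * stdAddChar (u * j) := by
    rw [← h, circEig, Finset.sum_mul]
    refine Fintype.sum_equiv (Equiv.subLeft u) _ _ fun w => ?_
    simp only [Equiv.subLeft_apply]
    have : w * j = -((u - w) * j) + u * j := by ring
    rw [this, AddChar.map_add_eq_mul]
    ring
  have := congrArg Complex.re key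
  simpa [Matrix.mulVec, dotProduct, circMatrix] using this

lemma circNorm_natCast {k : ℕ} (hk : k < N) :
    circNorm (k : ZMod N) = ((min k (N - k) : ℕ) : ℝ) := by
  rw [circNorm, valMinAbs_natAbs_eq_min, val_cast_of_lt hk]

lemma circNorm_secondDiff (hN : 2 ≤ N) (x : ZMod N) :
    circNorm (x + 1) + circNorm (x - 1) - 2 * circNorm x
      = 2 * (if x = 0 then 1 else 0) - (if x = ((N / 2 : ℕ) : ZMod N) then 1 else 0)
        - (if x = (((N + 1) / 2 : ℕ) : ZMod N) then 1 else 0) := by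
  obtain ⟨k, hk, rfl⟩ : ∃ k < N, x = (k : ZMod N) := ⟨x.val, x.val_lt, by simp⟩
  have heq : ∀ b : ℕ, b < N → ((k : ZMod N) = b ↔ k = b) := fun b hb =>
    ⟨fun h => by rw [← val_cast_of_lt hk, h, val_cast_of_lt hb], fun h => by rw [h]⟩
  have h1 : circNorm ((k : ZMod N) + 1) = ((min (k + 1) (N - (k + 1)) : ℕ) : ℝ) := by
    rcases Nat.lt_or_ge (k + 1) N with h | h
    · rw [← circNorm_natCast h]; push_cast; rfl
    · have : k + 1 = N := by omega
      have h0 : (k : ZMod N) + 1 = ((0 : ℕ) : ZMod N) := by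
        rw [← Nat.cast_add_one, this]; simp
      rw [h0, circNorm_natCast (by omega)]
      congr 1; omega
  have h2 : circNorm ((k : ZMod N) - 1)
      = ((if k = 0 then 1 else min (k - 1) (N - (k - 1)) : ℕ) : ℝ) := by
    split_ifs with h
    · have h0 : (k : ZMod N) - 1 = -((1 : ℕ) : ZMod N) := by simp [h]
      rw [h0, circNorm_neg, circNorm_natCast (by omega)]
      congr 1; omega
    · rw [← circNorm_natCast (by omega), Nat.cast_pred (by omega)]
  have h0 := heq 0 (by omega)
  rw [Nat.cast_zero] at h0
  simp only [h0, heq (N / 2) (by omega), heq ((N + 1) / 2) (by omega), h1, h2,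
    circNorm_natCast hk]
  have : ∀ a b c d e f : ℤ, a + b - 2 * c = 2 * d - e - f →
      (a : ℝ) + b - 2 * c = 2 * d - e - f := fun a b c d e f h => by exact_mod_cast h
  have := this ((min (k + 1) (N - (k + 1)) : ℕ))
    ((if k = 0 then 1 else min (k - 1) (N - (k - 1)) : ℕ)) ((min k (N - k) : ℕ))
    (if k = 0 then 1 else 0) (if k = N / 2 then 1 else 0) (if k = (N + 1) / 2 then 1 else 0)
    (by split_ifs <;> omega)
  simpa using this

/-- The real part of the standard additive character. -/
noncomputable def cosChar (x : ZMod N) : ℝ := (stdAddChar x).re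

lemma cosChar_neg (x : ZMod N) : cosChar (-x) = cosChar x := by
  rw [cosChar, ← conj_stdAddChar, Complex.conj_re, cosChar]

lemma stdAddChar_add_neg (x : ZMod N) :
    stdAddChar x + stdAddChar (-x) = ((2 * cosChar x : ℝ) : ℂ) := by
  rw [← conj_stdAddChar, Complex.add_conj, cosChar]

lemma circEig_mul (hN : 2 ≤ N) (j : ZMod N) :
    ((cosChar j - 1 : ℝ) : ℂ) * circEig j
      = ((1 - cosChar (((N / 2 : ℕ) : ZMod N) * j) : ℝ) : ℂ) := by
  have hshift : ∀ c : ZMod N, stdAddChar (c * j) * circEig j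
      = ∑ x : ZMod N, stdAddChar (-(x * j)) * (circNorm (x + c) : ℂ) := by
    intro c
    rw [circEig, Finset.mul_sum]
    refine Fintype.sum_equiv (Equiv.subRight c) _ _ fun x => ?_
    rw [← mul_assoc, ← AddChar.map_add_eq_mul]
    simp only [Equiv.subRight_apply, sub_add_cancel]
    congr 2; ring
  have hsum : (stdAddChar (1 * j) + stdAddChar (-1 * j) - 2) * circEig j
      = ∑ x : ZMod N, stdAddChar (-(x * j)) *
        (((circNorm (x + 1) + circNorm (x - 1) - 2 * circNorm x : ℝ)) : ℂ) := by
    rw [sub_mul, add_mul, hshift, hshift, circEig, Finset.mul_sum, ← Finset.sum_add_distrib,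
      ← Finset.sum_sub_distrib]
    refine Finset.sum_congr rfl fun x _ => ?_
    push_cast
    rw [← sub_eq_add_neg]
    ring
  have hneg : (((N + 1) / 2 : ℕ) : ZMod N) = -((N / 2 : ℕ) : ZMod N) := by
    rw [eq_neg_iff_add_eq_zero, ← Nat.cast_add, show (N + 1) / 2 + N / 2 = N by omega, natCast_self]
  simp_rw [circNorm_secondDiff hN] at hsum
  rw [hneg] at hsum
  push_cast at hsum
  simp only [apply_ite Complex.ofReal, Complex.ofReal_one, Complex.ofReal_zero, mul_sub, mul_ite,
    mul_one, mul_zero, Finset.sum_sub_distrib, Finset.sum_ite_eq',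
    Finset.mem_univ, if_true, one_mul, neg_mul, zero_mul, neg_zero, neg_neg,
    AddChar.map_zero_eq_one, stdAddChar_add_neg] at hsum
  have h3 := stdAddChar_add_neg (((N / 2 : ℕ) : ZMod N) * j)
  push_cast at hsum h3 ⊢
  linear_combination (1 / 2) * hsum - (1 / 2) * h3

lemma stdAddChar_re_sq_add_im_sq (x : ZMod N) :
    (stdAddChar x).re ^ 2 + (stdAddChar x).im ^ 2 = 1 := by
  have hn : ‖stdAddChar x‖ = 1 := AddChar.norm_apply _ _
  rw [sq, sq, ← Complex.normSq_apply, Complex.normSq_eq_norm_sq, hn, one_pow]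

lemma cosChar_eq_one_iff (x : ZMod N) : cosChar x = 1 ↔ x = 0 := by
  constructor
  · intro h
    apply injective_stdAddChar
    rw [AddChar.map_zero_eq_one]
    have h2 : (stdAddChar x).re ^ 2 + (stdAddChar x).im ^ 2 = 1 := stdAddChar_re_sq_add_im_sq x
    have h' : (stdAddChar x).re = 1 := h
    rw [h'] at h2
    exact Complex.ext h' (by simpa using h2)
  · rintro rfl
    simp [cosChar]

lemma cosChar_le_one (x : ZMod N) : cosChar x ≤ 1 :=
  (Complex.re_le_norm _).trans (AddChar.norm_apply _ _).le

lemma cosChar_lt_one {x : ZMod N} (hx : x ≠ 0) : cosChar x < 1 :=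
  lt_of_le_of_ne (cosChar_le_one x) fun h => hx ((cosChar_eq_one_iff x).1 h)

lemma circEig_eq (hN : 2 ≤ N) {j : ZMod N} (hj : j ≠ 0) :
    circEig j = ((-(1 - cosChar (((N / 2 : ℕ) : ZMod N) * j)) / (1 - cosChar j) : ℝ) : ℂ) := by
  have h := circEig_mul hN j
  have h1 : 1 - cosChar j ≠ 0 := (sub_pos.2 (cosChar_lt_one hj)).ne'
  have h2 : ((1 - cosChar j : ℝ) : ℂ) ≠ 0 := by exact_mod_cast h1
  rw [Complex.ofReal_div, eq_div_iff h2]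
  push_cast at h ⊢
  linear_combination -h

lemma cosChar_two_mul (x : ZMod N) : cosChar (2 * x) = 2 * cosChar x ^ 2 - 1 := by
  have h2 : (stdAddChar x).re ^ 2 + (stdAddChar x).im ^ 2 = 1 := stdAddChar_re_sq_add_im_sq x
  rw [cosChar, two_mul, AddChar.map_add_eq_mul, Complex.mul_re, cosChar]
  linarith

lemma cosChar_natCast (k : ℕ) : cosChar (k : ZMod N) = Real.cos (2 * π * k / N) := by
  have := stdAddChar_coe (N := N) (k : ℤ)
  rw [cosChar, ← Int.cast_natCast, this, ← Complex.exp_ofReal_mul_I_re]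
  congr 2
  push_cast
  ring

lemma cosChar_le_cos {x : ZMod N} (hx : x ≠ 0) : cosChar x ≤ Real.cos (2 * π / N) := by
  have hNpos : (0 : ℝ) < N := by exact_mod_cast Nat.pos_of_ne_zero (NeZero.ne N)
  have half : ∀ k : ℕ, 1 ≤ k → 2 * k ≤ N → Real.cos (2 * π * k / N) ≤ Real.cos (2 * π / N) := by
    intro k h1 h2
    have h1' : (1 : ℝ) ≤ k := by exact_mod_cast h1
    have h2' : 2 * (k : ℝ) ≤ N := by exact_mod_cast h2
    apply Real.cos_le_cos_of_nonneg_of_le_pi (by positivity)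
    · rw [div_le_iff₀ hNpos]; nlinarith [mul_le_mul_of_nonneg_left h2' pi_pos.le]
    · exact div_le_div_of_nonneg_right (le_mul_of_one_le_right (by positivity) h1') hNpos.le
  have hv : 1 ≤ x.val := Nat.one_le_iff_ne_zero.2 (by rwa [Ne, val_eq_zero])
  have hlt := x.val_lt
  rcases Nat.lt_or_ge N (2 * x.val) with h | h
  · have : x = -((N - x.val : ℕ) : ZMod N) := by
      rw [Nat.cast_sub hlt.le]; simp
    rw [this, cosChar_neg, cosChar_natCast]
    exact half _ (by omega) (by omega)
  · rw [← natCast_zmod_val x, cosChar_natCast]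
    exact half _ hv h

lemma circEig_zero_eq : circEig (0 : ZMod N) = ((∑ x : ZMod N, circNorm x : ℝ) : ℂ) := by
  simp [circEig]

lemma sum_circNorm_pos (hN : 2 ≤ N) : 0 < ∑ x : ZMod N, circNorm x := by
  refine Finset.sum_pos' (fun x _ => Nat.cast_nonneg _) ⟨((1 : ℕ) : ZMod N), Finset.mem_univ _, ?_⟩
  rw [circNorm_natCast (by omega)]
  exact_mod_cast (show 0 < min 1 (N - 1) by omega)

open scoped FourierTransform in
lemma eq_const_of_dft_eq_zero {v : ZMod N → ℝ}
    (h : ∀ j ≠ 0, ∑ w, stdAddChar (-(w * j)) * (v w : ℂ) = 0) (u : ZMod N) : v u = v 0 := by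
  set Φ : ZMod N → ℂ := fun w => (v w : ℂ)
  have hd : ∀ j ≠ 0, 𝓕 Φ j = 0 := fun j hj => by simpa [dft_apply, Φ] using h j hj
  have hinv : ∀ k, Φ k = (N : ℂ)⁻¹ • 𝓕 Φ 0 := by
    intro k
    conv_lhs => rw [← LinearEquiv.symm_apply_apply (dft (N := N) (E := ℂ)) Φ]
    rw [invDFT_apply, Fintype.sum_eq_single 0 fun j hj => by rw [hd j hj, smul_zero]]
    simp
  have : (v u : ℂ) = v 0 := (hinv u).trans (hinv 0).symm
  exact_mod_cast this

lemma dft_eq_zero_of_mulVec {v : ZMod N → ℝ} {μ ν : ℝ} (hv : (circMatrix N).mulVec v = μ • v)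
    {j : ZMod N} (hj : circEig j = ν) (hne : ν ≠ μ) :
    ∑ w, stdAddChar (-(w * j)) * (v w : ℂ) = 0 := by
  have h := sum_stdAddChar_mulVec v j
  have h' : (μ : ℂ) * ∑ w, stdAddChar (-(w * j)) * (v w : ℂ)
      = circEig j * ∑ w, stdAddChar (-(w * j)) * (v w : ℂ) := by
    rw [← h, hv, Finset.mul_sum]
    refine Finset.sum_congr rfl fun w _ => ?_
    simp only [Pi.smul_apply, smul_eq_mul, Complex.ofReal_mul]
    ring
  rw [hj] at h'
  by_contra h0
  exact hne (by exact_mod_cast (mul_right_cancel₀ h0 h').symm)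

lemma lambda2_circMatrix (hN : 2 ≤ N) {μ : ℝ} (hμ : μ ≤ 0) {j₁ : ZMod N}
    (hj₁ : circEig j₁ = μ) (hmax : ∀ j : ZMod N, j ≠ 0 → ∃ ν : ℝ, circEig j = ν ∧ ν ≤ μ) :
    lambda2 (circMatrix N) = μ := by
  have hA := circMatrix_isHermitian (N := N)
  have hex : ∀ {j : ZMod N} {ν : ℝ}, circEig j = ν → ∃ i, hA.eigenvalues i = ν := fun {j ν} h =>
    hA.exists_eigenvalues_eq (fun h0 => by simpa using congrFun h0 0) (circMatrix_mulVec_re h)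
  obtain ⟨i₀, hi₀⟩ := hex circEig_zero_eq
  obtain ⟨i₁, hi₁⟩ := hex hj₁
  have hpos := sum_circNorm_pos hN
  have hlt : hA.eigenvalues i₁ < hA.eigenvalues i₀ := by rw [hi₀, hi₁]; linarith
  have hconst : ∀ i, μ < hA.eigenvalues i →
      ∀ u, hA.eigenvectorBasis i u = hA.eigenvectorBasis i 0 := fun i hi =>
    eq_const_of_dft_eq_zero fun j hj => by
      obtain ⟨ν, hν, hle⟩ := hmax j hj
      exact dft_eq_zero_of_mulVec (hA.mulVec_eigenvectorBasis i) hν (by linarith)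
  have hnz : ∀ i, μ < hA.eigenvalues i → hA.eigenvectorBasis i 0 ≠ 0 := fun i hi h0 => by
    apply hA.eigenvectorBasis.orthonormal.ne_zero i
    ext u
    rw [hconst i hi u, h0]; rfl
  rw [← hi₁]
  refine kthLargestEig_two_eq hA (fun h => by rw [h] at hlt; exact lt_irrefl _ hlt) hlt.le
    fun i hi => ?_
  by_contra! hgt
  rw [hi₁] at hlt hgt
  have horth := hA.eigenvectorBasis.inner_eq_zero hi
  rw [PiLp.inner_apply] at horth
  simp only [hconst i hgt, hconst i₀ hlt] at horth
  have hN0 : N ≠ 0 := NeZero.ne N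
  simp [hnz i hgt, hnz i₀ hlt, hN0] at horth

lemma lambda2_circMatrix_of_even (hN : 3 ≤ N) (he : Even N) : lambda2 (circMatrix N) = 0 := by
  have h2 := two_ne_zero_of_three_le hN
  refine lambda2_circMatrix (by omega) le_rfl (j₁ := 2) ?_ fun j hj =>
    ⟨_, circEig_eq (by omega) hj, ?_⟩
  · have : ((N / 2 : ℕ) : ZMod N) * 2 = 0 := by
      exact_mod_cast (congrArg (Nat.cast : ℕ → ZMod N) (Nat.div_mul_cancel he.two_dvd)).trans
        (natCast_self N)
    rw [circEig_eq (by omega) h2, this, (cosChar_eq_one_iff 0).2 rfl]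
    simp
  · exact div_nonpos_of_nonpos_of_nonneg (by linarith [cosChar_le_one (((N / 2 : ℕ) : ZMod N) * j)])
      (by linarith [cosChar_le_one j])

lemma exists_circEig_eq_of_odd (hN : 2 ≤ N) (ho : Odd N) {j : ZMod N} (hj : j ≠ 0) :
    ((N / 2 : ℕ) : ZMod N) * j ≠ 0 ∧ -1 < cosChar (((N / 2 : ℕ) : ZMod N) * j) ∧
      circEig j = ((-(1 / (2 * (1 + cosChar (((N / 2 : ℕ) : ZMod N) * j)))) : ℝ) : ℂ) := by
  set t : ZMod N := ((N / 2 : ℕ) : ZMod N) * j with ht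
  have hjt : j = -(2 * t) := by
    have : (2 : ZMod N) * (N / 2 : ℕ) = -1 := by
      rw [eq_neg_iff_add_eq_zero]
      have h : 2 * (N / 2) + 1 = N := by obtain ⟨k, rfl⟩ := ho; omega
      exact_mod_cast (congrArg (Nat.cast : ℕ → ZMod N) h).trans (natCast_self N)
    rw [ht, ← mul_assoc, this]; ring
  have ht0 : t ≠ 0 := fun h => hj (by rw [hjt, h]; simp)
  have hc : cosChar j = 2 * cosChar t ^ 2 - 1 := by
    conv_lhs => rw [hjt]
    rw [cosChar_neg, cosChar_two_mul]
  have hj1 := cosChar_lt_one hj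
  have ht1 := cosChar_lt_one ht0
  have hgt : -1 < cosChar t := by nlinarith
  refine ⟨ht0, hgt, ?_⟩
  rw [circEig_eq hN hj, ← ht, hc]
  congr 1
  have h1 : 1 - cosChar t ≠ 0 := by linarith
  have h2 : 1 + cosChar t ≠ 0 := by linarith
  have h3 : 1 - (2 * cosChar t ^ 2 - 1) = 2 * (1 - cosChar t) * (1 + cosChar t) := by ring
  rw [h3]
  field_simp

lemma lambda2_circMatrix_of_odd (hN : 3 ≤ N) (ho : Odd N) :
    lambda2 (circMatrix N) = -(1 / 4) * ((Real.cos (π / N))⁻¹) ^ 2 := by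
  have h2 := two_ne_zero_of_three_le hN
  have hval : -(1 / 4) * ((Real.cos (π / N))⁻¹) ^ 2 = -(1 / (2 * (1 + Real.cos (2 * π / N)))) := by
    rw [mul_div_assoc, Real.cos_two_mul, inv_pow, show
      2 * (1 + (2 * Real.cos (π / N) ^ 2 - 1)) = 4 * Real.cos (π / N) ^ 2 by ring, one_div, one_div,
      mul_inv]
    ring
  rw [hval]
  have hmul : ((N / 2 : ℕ) : ZMod N) * 2 = -((1 : ℕ) : ZMod N) := by
    rw [eq_neg_iff_add_eq_zero]
    have h : N / 2 * 2 + 1 = N := by obtain ⟨k, rfl⟩ := ho; omega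
    exact_mod_cast (congrArg (Nat.cast : ℕ → ZMod N) h).trans (natCast_self N)
  refine lambda2_circMatrix (by omega) ?_ (j₁ := 2) ?_ fun j hj => ?_
  · have := Real.neg_one_le_cos (2 * π / N)
    rw [neg_nonpos]
    exact one_div_nonneg.2 (by linarith)
  · rw [(exists_circEig_eq_of_odd (by omega) ho h2).2.2, hmul, cosChar_neg, cosChar_natCast]
    simp
  · obtain ⟨ht, hgt, heq⟩ := exists_circEig_eq_of_odd (by omega) ho hj
    refine ⟨_, heq, neg_le_neg (one_div_le_one_div_of_le (by linarith) ?_)⟩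
    linarith [cosChar_le_cos ht]

end ZMod

namespace SimpleGraph

/-- The cycle graph with vertices labelled by `ZMod (k + 2)`. -/
def zmodCycle (k : ℕ) : SimpleGraph (ZMod (k + 2)) := cycleGraph (k + 2)

lemma zmodCycle_adj {k : ℕ} {u v : ZMod (k + 2)} :
    (zmodCycle k).Adj u v ↔ u - v = 1 ∨ v - u = 1 :=
  cycleGraph_adj

lemma zmodCycle_dist {k : ℕ} (u v : ZMod (k + 2)) :
    (zmodCycle k).dist u v = (u - v).valMinAbs.natAbs := by
  have hconn : (zmodCycle k).Connected := cycleGraph_connected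
  apply le_antisymm
  · have hup : ∀ (m : ℕ) (w : ZMod (k + 2)), (zmodCycle k).dist (w + m) w ≤ m := by
      intro m w
      induction m with
      | zero => simp
      | succ m ih =>
        have hadj : (zmodCycle k).Adj (w + (m + 1 : ℕ)) (w + m) :=
          zmodCycle_adj.2 (Or.inl (by push_cast; ring))
        have h := hconn.dist_triangle (u := w + (m + 1 : ℕ)) (v := w + m) (w := w)
        rw [dist_eq_one_iff_adj.2 hadj] at h
        omega
    have hx := ZMod.coe_valMinAbs (u - v)
    rcases Int.natAbs_eq (u - v).valMinAbs with h | h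
    · rw [h] at hx
      have : u = v + ((u - v).valMinAbs.natAbs : ℕ) := by
        rw [Int.cast_natCast] at hx; rw [hx]; ring
      conv_lhs => rw [this]
      exact hup _ _
    · rw [h] at hx
      have : v = u + ((u - v).valMinAbs.natAbs : ℕ) := by
        rw [Int.cast_neg, Int.cast_natCast] at hx
        linear_combination hx
      conv_lhs => rw [this, dist_comm]
      exact hup _ _
  · have hlow : ∀ {a b : ZMod (k + 2)} (p : (zmodCycle k).Walk a b),
        (a - b).valMinAbs.natAbs ≤ p.length := by
      intro a b p
      induction p with
      | nil => simp
      | @cons a c b h p ih =>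
        have hac : (a - c : ZMod (k + 2)).valMinAbs.natAbs ≤ 1 := by
          have h1 : (1 : ZMod (k + 2)).valMinAbs.natAbs ≤ 1 := by
            rw [ZMod.valMinAbs_natAbs_eq_min, ZMod.val_one'' (by omega)]
            exact min_le_left _ _
          rcases zmodCycle_adj.1 h with h | h
          · exact h ▸ h1
          · rw [← neg_sub, ZMod.natAbs_valMinAbs_neg]
            exact h ▸ h1
        have h2 := ZMod.natAbs_valMinAbs_add_le (a - c : ZMod (k + 2)) (c - b)
        have h3 := Int.natAbs_add_le (a - c : ZMod (k + 2)).valMinAbs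
          (c - b : ZMod (k + 2)).valMinAbs
        have h4 : (a - c : ZMod (k + 2)) + (c - b) = (a - b : ZMod (k + 2)) := by abel
        rw [h4] at h2
        rw [Walk.length_cons]
        have ih' : (c - b : ZMod (k + 2)).valMinAbs.natAbs ≤ p.length := ih
        exact h2.trans (h3.trans (by omega))
    obtain ⟨p, hp⟩ := hconn.exists_walk_length_eq_dist u v
    exact hp ▸ hlow p

lemma lambda2_distMatrix_cycleGraph {n : ℕ} [NeZero n] (hn : 2 ≤ n) :
    lambda2 (distMatrix (cycleGraph n)) = lambda2 (ZMod.circMatrix n) := by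
  obtain ⟨k, rfl⟩ := Nat.exists_eq_add_of_le' hn
  have : (distMatrix (cycleGraph (k + 2)) : Matrix (ZMod (k + 2)) (ZMod (k + 2)) ℝ)
      = ZMod.circMatrix (k + 2) := by
    ext u v
    exact congrArg Nat.cast (zmodCycle_dist u v)
  exact congrArg lambda2 this

end SimpleGraph

theorem lambda2_cycleGraph (n : ℕ) (hn : 3 ≤ n) :
    (Even n → lambda2 (distMatrix (SimpleGraph.cycleGraph n)) = 0) ∧
    (Odd n → lambda2 (distMatrix (SimpleGraph.cycleGraph n)) =
      -(1/4) * ((Real.cos (Real.pi / n))⁻¹) ^ 2) := by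
  have : NeZero n := ⟨by omega⟩
  rw [SimpleGraph.lambda2_distMatrix_cycleGraph (by omega)]
  exact ⟨ZMod.lambda2_circMatrix_of_even hn, ZMod.lambda2_circMatrix_of_odd hn⟩
end
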